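/- For any real number b with 0.916027 < b < 1, the inequality 2 < ((2b)^b · (1-b)^(1-b))^2 holds; equivalently 2/((2b)^(2b) · (1-b)^(2(1-b))) < 1. -/

import Mathlib

/-- Tangent-line bound for the convex function `x ↦ x * log x`. -/
lemma Real.mul_log_add_sub_le_mul_log {a x : ℝ} (ha : 0 < a) (hx : 0 < x) :
    x * Real.log a + x - a ≤ x * Real.log x := by
  have h := Real.log_le_sub_one_of_pos (div_pos ha hx)
  rw [Real.log_div ha.ne' hx.ne'] at h
  have h' := mul_le_mul_of_nonneg_left h hx.le
  have e : x * (a / x - 1) = a - x := by field_simp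
  linarith

lemma log_lower_bound_916027 : -0.08770947 < Real.log 0.916027 := by
  have h := Real.log_div_le_sum_range_add (x := 0.083973 / 1.916027)
    (by norm_num) (by norm_num) 4
  have e : (1 + 0.083973 / 1.916027 : ℝ) / (1 - 0.083973 / 1.916027) = (0.916027)⁻¹ := by
    norm_num
  rw [e, Real.log_inv] at h
  norm_num [Finset.sum_range_succ] at h ⊢
  linarith

lemma log_lower_bound_083973 : -2.4772600 < Real.log 0.083973 := by
  have h := Real.sum_range_le_log_div (x := 0.343568 / 2.343568)
    (by norm_num) (by norm_num) 4
  have e : (1 + 0.343568 / 2.343568 : ℝ) / (1 - 0.343568 / 2.343568) = 2 ^ 4 * 0.083973 := by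
    norm_num
  rw [e, Real.log_mul (by norm_num) (by norm_num), Real.log_pow] at h
  have h2 := Real.log_two_lt_d9
  norm_num [Finset.sum_range_succ] at h h2 ⊢
  linarith

/-- For 0.916027 < b < 1 we have 2 < ((2b)^b (1-b)^(1-b))². -/
theorem stmt_3 (b : ℝ) (h₁ : 0.916027 < b) (h₂ : b < 1) :
    2 < ((2 * b) ^ b * (1 - b) ^ (1 - b)) ^ (2 : ℕ) := by
  have hb : 0 < b := by linarith
  have hc : 0 < 1 - b := by linarith
  rw [← Real.log_lt_log_iff (by norm_num) (by positivity), Real.log_pow,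
    Real.log_mul (by positivity) (by positivity), Real.log_rpow (by positivity),
    Real.log_rpow hc, Real.log_mul (by norm_num) hb.ne']
  have t₁ := Real.mul_log_add_sub_le_mul_log (a := 0.916027) (by norm_num) hb
  have t₂ := Real.mul_log_add_sub_le_mul_log (a := 0.083973) (by norm_num) hc
  have l₁ := mul_le_mul_of_nonneg_left log_lower_bound_916027.le hb.le
  have l₂ := mul_le_mul_of_nonneg_left log_lower_bound_083973.le hc.le
  have l₃ := mul_le_mul_of_nonneg_left Real.log_two_gt_d9.le (by linarith : 0 ≤ 2 * b - 1)
  push_cast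
  linarith
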